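/- The symplectic Hodge star squares to the identity: let V = ℝ^{2m} with standard basis e_1,…,e_m,f_1,…,f_m and dual basis elements q_i = e_i^*, p_i = f_i^*, let ω = Σ_i q_i ∧ p_i ∈ Λ²(V^*) be the standard symplectic form, Π the bilinear form on V^* determined by Π(q_i, p_j) = δ_{ij}, Π(p_i, q_j) = −δ_{ij}, Π(q_i, q_j) = Π(p_i, p_j) = 0, and ν = (1/m!) ω^m ∈ Λ^{2m}(V^*) the symplectic volume element. For each 0 ≤ k ≤ 2m, let Λ^kΠ be the unique bilinear form on the k-th exterior power Λ^k(V^*) satisfying Λ^kΠ(α_1 ∧ ⋯ ∧ α_k, β_1 ∧ ⋯ ∧ β_k) = det(Π(α_i, β_j))_{i,j} on decomposable elements. Then there exists a unique linear map ∗ : Λ^k(V^*) → Λ^{2m−k}(V^*) such that α ∧ (∗β) = Λ^kΠ(α, β) · ν for all α, β ∈ Λ^k(V^*), and this map satisfies ∗(∗β) = β for all β ∈ Λ^k(V^*) (i.e. the composition Λ^k(V^*) → Λ^{2m−k}(V^*) → Λ^k(V^*) of the star maps in degrees k and 2m−k is the identity). -/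

import Mathlib

noncomputable section

/-- The dual `V^*` of `V = ℝ^{2m}`, with coordinates indexed by `Fin m ⊕ Fin m`:
`Sum.inl i` indexes `q_i = e_i^*` and `Sum.inr i` indexes `p_i = f_i^*`. -/
abbrev DualV (m : ℕ) := (Fin m ⊕ Fin m) → ℝ

/-- The standard Poisson pairing `Π` on `V^*`, the bilinear form determined by
`Π(q_i, p_j) = δ_{ij}`, `Π(p_i, q_j) = −δ_{ij}`, `Π(q_i, q_j) = Π(p_i, p_j) = 0`. -/
def PiPairing {m : ℕ} (x y : DualV m) : ℝ :=
  ∑ i : Fin m, (x (Sum.inl i) * y (Sum.inr i) - x (Sum.inr i) * y (Sum.inl i))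

/-- The standard symplectic form `ω = Σ_i q_i ∧ p_i` in the exterior algebra of `V^*`. -/
def symplForm (m : ℕ) : ExteriorAlgebra ℝ (DualV m) :=
  ∑ i : Fin m,
    ExteriorAlgebra.ι ℝ (Pi.single (Sum.inl i) (1 : ℝ)) *
      ExteriorAlgebra.ι ℝ (Pi.single (Sum.inr i) (1 : ℝ))

/-- The symplectic volume element `ν = (1/m!) ω^m ∈ Λ^{2m}(V^*)`. -/
def symplVol (m : ℕ) : ExteriorAlgebra ℝ (DualV m) :=
  ((m.factorial : ℝ)⁻¹) • symplForm m ^ m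

/-- The decomposable element `α_1 ∧ ⋯ ∧ α_k` as an element of `⋀^k (V^*)`. -/
def wedgeTuple (m k : ℕ) (v : Fin k → DualV m) : ⋀[ℝ]^k (DualV m) :=
  ⟨ExteriorAlgebra.ιMulti ℝ k v,
    ExteriorAlgebra.ιMulti_range ℝ k (Set.mem_range_self v)⟩

namespace SympStar

open ExteriorAlgebra Module

/-- The compatible complex structure. -/
def JJ (m : ℕ) : DualV m →ₗ[ℝ] DualV m where
  toFun y := Sum.elim (fun i => - y (Sum.inr i)) (fun i => y (Sum.inl i))
  map_add' x y := by ext (i | i) <;> simp [add_comm]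
  map_smul' x y := by ext (i | i) <;> simp

lemma JJ_JJ (m : ℕ) (x : DualV m) : JJ m (JJ m x) = -x := by
  ext (i | i) <;> simp [JJ]

lemma Pi_JJ_JJ {m : ℕ} (x y : DualV m) : PiPairing (JJ m x) (JJ m y) = PiPairing x y := by
  simp only [PiPairing, JJ, LinearMap.coe_mk, AddHom.coe_mk, Sum.elim_inl, Sum.elim_inr]
  exact Finset.sum_congr rfl fun i _ => by ring

lemma JJ_q (m : ℕ) (i : Fin m) :
    JJ m (Pi.single (Sum.inl i) 1) = Pi.single (Sum.inr i) 1 := by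
  ext (j | j) <;> simp [JJ, Pi.single_apply]

lemma JJ_p (m : ℕ) (i : Fin m) :
    JJ m (Pi.single (Sum.inr i) 1) = - Pi.single (Sum.inl i) 1 := by
  ext (j | j) <;> simp [JJ, Pi.single_apply]

lemma map_symplVol (m : ℕ) : ExteriorAlgebra.map (JJ m) (symplVol m) = symplVol m := by
  have : ExteriorAlgebra.map (JJ m) (symplForm m) = symplForm m := by
    simp only [symplForm, map_sum, map_mul, map_apply_ι, JJ_q, JJ_p, map_neg]
    refine Finset.sum_congr rfl fun i _ => ?_
    rw [mul_neg, neg_eq_iff_add_eq_zero, ι_add_mul_swap]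
  simp [symplVol, this]

def ee (m : ℕ) : Fin m ⊕ Fin m ≃ Fin (m * 2) :=
  Equiv.trans
    { toFun := (Sum.elim (fun i => (i, 0)) (fun i => (i, 1)) : Fin m ⊕ Fin m → Fin m × Fin 2)
      invFun := fun x => if x.2 = 0 then Sum.inl x.1 else Sum.inr x.1
      left_inv := by rintro (i | i) <;> simp
      right_inv := by rintro ⟨i, j⟩; fin_cases j <;> simp } finProdFinEquiv

def bb (m : ℕ) : Basis (Fin (m * 2)) ℝ (DualV m) := (Pi.basisFun ℝ _).reindex (ee m)

lemma bb_apply (m : ℕ) (j : Fin (m * 2)) : bb m j = Pi.single ((ee m).symm j) 1 := by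
  simp [bb]

lemma Pi_bb (m : ℕ) (j : Fin (m * 2)) (x : DualV m) :
    PiPairing x (JJ m (bb m j)) = (bb m).coord j x := by
  rw [bb_apply]
  simp only [bb, Basis.coord_apply, Basis.repr_reindex_apply, Pi.basisFun_repr]
  generalize (ee m).symm j = s
  rcases s with i | i
  · simp [JJ_q, PiPairing, Pi.single_apply]
  · simp [JJ_p, PiPairing, Pi.single_apply]

lemma pow_sum_sq_zero {A : Type*} [Ring A] (n : ℕ) (a : Fin n → A)
    (hc : ∀ i j, Commute (a i) (a j)) (hz : ∀ i, a i * a i = 0) :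
    (∑ i, a i) ^ n = n.factorial • (List.ofFn a).prod ∧ (∑ i, a i) ^ (n + 1) = 0 := by
  induction n with
  | zero => simp
  | succ n ih =>
    obtain ⟨h1, h2⟩ := ih (fun i => a i.succ) (fun _ _ => hc _ _) (fun _ => hz _)
    have hcom : Commute (a 0) (∑ i : Fin n, a i.succ) :=
      Commute.sum_right _ _ _ fun i _ => hc _ _
    have key : ∀ N : ℕ, (a 0 + ∑ i : Fin n, a i.succ) ^ (N + 1) =
        (∑ i : Fin n, a i.succ) ^ (N + 1) + (N + 1) • (a 0 * (∑ i : Fin n, a i.succ) ^ N) := by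
      generalize (∑ i : Fin n, a i.succ) = S at hcom
      have h0 := hz 0
      generalize a 0 = x at hcom h0
      intro N
      induction N with
      | zero => simp [add_comm]
      | succ N ih =>
        rw [pow_succ' (x + S), ih, add_mul, mul_add, mul_add, mul_smul_comm, mul_smul_comm,
          ← mul_assoc x x, h0, ← mul_assoc S x, ← hcom.eq, mul_assoc x S, ← pow_succ', ← pow_succ',
          zero_mul, smul_zero, add_zero, succ_nsmul _ (N + 1)]
        abel
    rw [Fin.sum_univ_succ]
    constructor
    · rw [key, h2, h1, List.ofFn_succ, List.prod_cons, zero_add, mul_smul_comm, smul_smul,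
        Nat.factorial_succ]
    · rw [key, pow_succ, h2]; simp

lemma ι_comm_pair {M : Type*} [AddCommGroup M] [Module ℝ M] (x y z : M) :
    ι ℝ x * (ι ℝ y * ι ℝ z) = (ι ℝ y * ι ℝ z) * ι ℝ x := by
  have h1 := eq_neg_of_add_eq_zero_left (ι_add_mul_swap (R := ℝ) x y)
  have h2 := eq_neg_of_add_eq_zero_left (ι_add_mul_swap (R := ℝ) x z)
  rw [← mul_assoc, h1, neg_mul, mul_assoc, h2, mul_neg, neg_neg, mul_assoc]

lemma bb_top (m : ℕ) : (bb m).ExteriorAlgebra Finset.univ = symplVol m := by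
  have hcard : (Finset.univ : Finset (Fin (m * 2))).card = m * 2 := by simp
  rw [basis_apply_ofCard (bb m) hcard]
  have h1 : ιMulti_family ℝ (m * 2) (bb m) (Set.powersetCard.ofCard hcard) =
      ιMulti ℝ (m * 2) (bb m) := by
    have : (Finset.univ : Finset (Fin (m * 2))).orderEmbOfFin hcard = RelEmbedding.refl _ := by
      apply DFunLike.coe_injective
      refine (Finset.orderEmbOfFin_unique hcard (fun _ => Finset.mem_univ _) strictMono_id).symm
    simp only [ιMulti_family]
    congr 1
    ext1 j
    simp only [Function.comp, Set.powersetCard.ofFinEmbEquiv_symm_apply]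
    congr 1
    exact DFunLike.congr_fun this j
  rw [h1, ιMulti_apply, List.ofFn_mul, symplVol, symplForm, (pow_sum_sq_zero _ _ ?_ ?_).1,
    ← Nat.cast_smul_eq_nsmul ℝ, smul_smul, inv_mul_cancel₀ (by positivity), one_smul,
    List.prod_flatten, List.map_ofFn]
  · congr 2
    ext1 i
    have e0 : (ee m).symm ⟨i * 2 + 0, by omega⟩ = Sum.inl i := by
      rw [Equiv.symm_apply_eq]; ext; simp [ee, finProdFinEquiv, mul_comm]
    have e1 : (ee m).symm ⟨i * 2 + 1, by omega⟩ = Sum.inr i := by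
      rw [Equiv.symm_apply_eq]; ext; simp [ee, finProdFinEquiv, mul_comm, add_comm]
    simp only [Function.comp, bb_apply, List.ofFn_succ, List.ofFn_zero, List.prod_cons,
      List.prod_nil, mul_one]
    erw [e0, e1]
  · intro i j
    unfold Commute SemiconjBy
    rw [mul_assoc, ι_comm_pair, ← mul_assoc, ι_comm_pair, mul_assoc]
  · intro i
    rw [← mul_assoc, ← ι_comm_pair, ← mul_assoc, ι_sq_zero, zero_mul, zero_mul]

lemma ι_mul_ιMulti {M : Type*} [AddCommGroup M] [Module ℝ M] (x : M) (k : ℕ) (v : Fin k → M) :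
    ι ℝ x * ιMulti ℝ k v = (-1 : ℝ) ^ k • (ιMulti ℝ k v * ι ℝ x) := by
  induction k with
  | zero => simp
  | succ k ih =>
    have h1 := eq_neg_of_add_eq_zero_left (ι_add_mul_swap (R := ℝ) x (v 0))
    rw [ιMulti_succ_apply, ← mul_assoc, h1, neg_mul, mul_assoc, ih, pow_succ]
    simp [mul_assoc]

lemma ιMulti_mul_comm {M : Type*} [AddCommGroup M] [Module ℝ M] (k l : ℕ) (v : Fin k → M)
    (w : Fin l → M) :
    ιMulti ℝ l w * ιMulti ℝ k v = (-1 : ℝ) ^ (k * l) • (ιMulti ℝ k v * ιMulti ℝ l w) := by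
  induction l with
  | zero => simp
  | succ l ih =>
    rw [ιMulti_succ_apply, mul_assoc, ih, mul_smul_comm, ← mul_assoc, ι_mul_ιMulti, smul_mul_assoc,
      smul_smul, mul_assoc, mul_add, pow_add, mul_one]

lemma coe_map {m k : ℕ} (x : ⋀[ℝ]^k (DualV m)) :
    (exteriorPower.map k (JJ m) x : ExteriorAlgebra ℝ (DualV m)) =
      ExteriorAlgebra.map (JJ m) (x : ExteriorAlgebra ℝ (DualV m)) := by
  have : (⋀[ℝ]^k (DualV m)).subtype ∘ₗ exteriorPower.map k (JJ m) =
      (ExteriorAlgebra.map (JJ m)).toLinearMap ∘ₗ (⋀[ℝ]^k (DualV m)).subtype := by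
    ext v
    simp
  exact LinearMap.congr_fun this x

lemma map_map {m k : ℕ} (x : ⋀[ℝ]^k (DualV m)) :
    exteriorPower.map k (JJ m) (exteriorPower.map k (JJ m) x) = (-1 : ℝ) ^ k • x := by
  have : exteriorPower.map k (JJ m) ∘ₗ exteriorPower.map k (JJ m) =
      (-1 : ℝ) ^ k • LinearMap.id := by
    apply exteriorPower.linearMap_ext
    ext1 v
    have h := (exteriorPower.ιMulti ℝ k (M := DualV m)).toMultilinearMap.map_smul_univ
      (fun _ => (-1 : ℝ)) v
    simp only [LinearMap.compAlternatingMap_apply, LinearMap.comp_apply,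
      exteriorPower.map_apply_ιMulti, LinearMap.smul_apply, LinearMap.id_apply]
    simp only [Finset.prod_const, Finset.card_univ, Fintype.card_fin] at h
    refine Eq.trans (congrArg (exteriorPower.ιMulti ℝ k) (funext fun i => ?_)) h
    simp [JJ_JJ]
  exact LinearMap.congr_fun this x

lemma B_map_map {m k : ℕ} (B : ⋀[ℝ]^k (DualV m) →ₗ[ℝ] ⋀[ℝ]^k (DualV m) →ₗ[ℝ] ℝ)
    (hB : ∀ v w : Fin k → DualV m,
      B (wedgeTuple m k v) (wedgeTuple m k w) =
        Matrix.det (Matrix.of fun i j => PiPairing (v i) (w j))) (x y : ⋀[ℝ]^k (DualV m)) :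
    B (exteriorPower.map k (JJ m) x) (exteriorPower.map k (JJ m) y) = B x y := by
  have : B.compl₁₂ (exteriorPower.map k (JJ m)) (exteriorPower.map k (JJ m)) = B := by
    apply exteriorPower.linearMap_ext
    ext1 v
    apply exteriorPower.linearMap_ext
    ext1 w
    simp only [LinearMap.compAlternatingMap_apply, LinearMap.compl₁₂_apply,
      exteriorPower.map_apply_ιMulti]
    refine (hB _ _).trans (Eq.trans ?_ (hB _ _).symm)
    simp [Pi_JJ_JJ]
  exact LinearMap.congr_fun₂ this x y

lemma B_bb {m k : ℕ} (B : ⋀[ℝ]^k (DualV m) →ₗ[ℝ] ⋀[ℝ]^k (DualV m) →ₗ[ℝ] ℝ)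
    (hB : ∀ v w : Fin k → DualV m,
      B (wedgeTuple m k v) (wedgeTuple m k w) =
        Matrix.det (Matrix.of fun i j => PiPairing (v i) (w j))) (x : ⋀[ℝ]^k (DualV m))
    (s : Set.powersetCard (Fin (m * 2)) k) :
    B x (exteriorPower.map k (JJ m) ((bb m).exteriorPower k s)) =
      ((bb m).exteriorPower k).coord s x := by
  rw [exteriorPower.basis_coord]
  have : B.flip (exteriorPower.map k (JJ m) ((bb m).exteriorPower k s)) =
      exteriorPower.ιMultiDual ℝ k (bb m) s := by
    apply exteriorPower.linearMap_ext
    ext1 v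
    simp only [LinearMap.compAlternatingMap_apply, LinearMap.flip_apply,
      exteriorPower.basis_apply, exteriorPower.ιMulti_family,
      exteriorPower.map_apply_ιMulti, exteriorPower.ιMultiDual_apply_ιMulti]
    refine (hB _ _).trans ?_
    simp only [Function.comp, Pi_bb]
  exact LinearMap.congr_fun this x

section core

variable {m k l : ℕ}

lemma cardeq (h : k + l = m * 2) : l + k = Fintype.card (Fin (m * 2)) := by simp; omega

/-- Complement of index sets. -/
def cc (h : k + l = m * 2) :
    Set.powersetCard (Fin (m * 2)) k ≃ Set.powersetCard (Fin (m * 2)) l :=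
  Set.powersetCard.compl (cardeq h)

lemma exists_eps (h : k + l = m * 2) (S : Set.powersetCard (Fin (m * 2)) k) :
    ∃ ε : ℝ, ε * ε = 1 ∧
      ((bb m).exteriorPower k S : ExteriorAlgebra ℝ (DualV m)) * (bb m).exteriorPower l (cc h S) =
        ε • symplVol m := by
  have hd : Disjoint S.val (cc h S).val := by
    simp only [cc, Set.powersetCard.coe_compl]
    exact disjoint_compl_right
  refine ⟨(((Set.powersetCard.permOfDisjoint hd).sign : ℤ) : ℝ), ?_, ?_⟩
  · rw [← Int.cast_mul, Int.units_coe_mul_self, Int.cast_one]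
  · rw [← basis_eq_coe_basis, ← basis_eq_coe_basis, basis_mul_of_disjoint _ _ _ hd, ← bb_top]
    have : ((Set.powersetCard.disjUnion hd : Set.powersetCard _ _) : Finset (Fin (m * 2)))
        = Finset.univ := by
      ext a
      simp [cc, Set.powersetCard.coe_disjUnion]
    rw [this, Units.smul_def, Int.cast_smul_eq_zsmul]

lemma mul_ne (h : k + l = m * 2) (S T : Set.powersetCard (Fin (m * 2)) k) (hST : S ≠ T) :
    ((bb m).exteriorPower k S : ExteriorAlgebra ℝ (DualV m)) * (bb m).exteriorPower l (cc h T) =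
      0 := by
  rw [← basis_eq_coe_basis, ← basis_eq_coe_basis]
  apply basis_mul_of_not_disjoint
  obtain ⟨a, ha, hb⟩ := (Set.powersetCard.exists_mem_notMem_iff_ne S T).1 hST
  rw [Finset.not_disjoint_iff]
  refine ⟨a, ha, ?_⟩
  exact Finset.mem_compl.2 hb

lemma vol_ne : symplVol m ≠ 0 := by
  rw [← bb_top]; exact Basis.ne_zero _ _

lemma mul_sum (h : k + l = m * 2) (ε : Set.powersetCard (Fin (m * 2)) k → ℝ)
    (hε : ∀ S, ((bb m).exteriorPower k S : ExteriorAlgebra ℝ (DualV m)) *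
      (bb m).exteriorPower l (cc h S) = ε S • symplVol m)
    (c : Set.powersetCard (Fin (m * 2)) k → ℝ) (S : Set.powersetCard (Fin (m * 2)) k) :
    ((bb m).exteriorPower k S : ExteriorAlgebra ℝ (DualV m)) *
      ((∑ T, c T • (bb m).exteriorPower l (cc h T) : ⋀[ℝ]^l (DualV m)) :
        ExteriorAlgebra ℝ (DualV m)) = (c S * ε S) • symplVol m := by
  rw [AddSubmonoidClass.coe_finsetSum, Finset.mul_sum, Finset.sum_eq_single S]
  · rw [Submodule.coe_smul, mul_smul_comm, hε, smul_smul]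
  · intro T _ hT
    rw [Submodule.coe_smul, mul_smul_comm, mul_ne h S T hT.symm, smul_zero]
  · simp

lemma cancel (h : k + l = m * 2) (y z : ⋀[ℝ]^l (DualV m))
    (hyz : ∀ x : ⋀[ℝ]^k (DualV m), (x : ExteriorAlgebra ℝ (DualV m)) * y =
      (x : ExteriorAlgebra ℝ (DualV m)) * z) : y = z := by
  choose ε h1 hε using exists_eps (m := m) h
  rw [← sub_eq_zero]
  set w := y - z with hw
  have h0 : ∀ x : ⋀[ℝ]^k (DualV m), (x : ExteriorAlgebra ℝ (DualV m)) * w = 0 := by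
    intro x
    rw [hw, Submodule.coe_sub, mul_sub, hyz, sub_self]
  set B' := ((bb m).exteriorPower l).reindex (cc h).symm with hB'
  have hsum := B'.sum_repr w
  simp only [hB', Basis.reindex_apply, Equiv.symm_symm] at hsum
  rw [← hB'] at hsum
  apply B'.ext_elem
  intro S
  have := mul_sum h ε hε (fun T => B'.repr w T) S
  rw [hsum, h0] at this
  rcases smul_eq_zero.1 this.symm with h2 | h2
  · have : ε S ≠ 0 := fun h3 => by simpa [h3] using h1 S
    simpa [this] using h2
  · exact absurd h2 vol_ne

/-- The defining property of the star. -/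
def IsStar (B : ⋀[ℝ]^k (DualV m) →ₗ[ℝ] ⋀[ℝ]^k (DualV m) →ₗ[ℝ] ℝ)
    (star : ⋀[ℝ]^k (DualV m) →ₗ[ℝ] ⋀[ℝ]^l (DualV m)) : Prop :=
  ∀ α β : ⋀[ℝ]^k (DualV m),
        (α : ExteriorAlgebra ℝ (DualV m)) * (star β : ExteriorAlgebra ℝ (DualV m)) =
          B α β • symplVol m

lemma exists_star (h : k + l = m * 2)
    (B : ⋀[ℝ]^k (DualV m) →ₗ[ℝ] ⋀[ℝ]^k (DualV m) →ₗ[ℝ] ℝ) :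
    ∃! star : ⋀[ℝ]^k (DualV m) →ₗ[ℝ] ⋀[ℝ]^l (DualV m), IsStar B star := by
  choose ε h1 hε using exists_eps (m := m) h
  have hs : IsStar B (∑ T, (ε T • B ((bb m).exteriorPower k T)).smulRight
      ((bb m).exteriorPower l (cc h T))) := by
    intro α β
    have : (LinearMap.mulRight ℝ ((∑ T, (ε T • B ((bb m).exteriorPower k T)).smulRight
        ((bb m).exteriorPower l (cc h T))) β : ExteriorAlgebra ℝ (DualV m))) ∘ₗ
        (⋀[ℝ]^k (DualV m)).subtype = (B.flip β).smulRight (symplVol m) := by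
      apply ((bb m).exteriorPower k).ext
      intro S
      have := mul_sum h ε hε (fun T => ε T * B ((bb m).exteriorPower k T) β) S
      rw [mul_right_comm, h1, one_mul] at this
      simp only [LinearMap.comp_apply, LinearMap.mulRight_apply, LinearMap.smulRight_apply,
        LinearMap.sum_apply, LinearMap.smul_apply, smul_eq_mul, LinearMap.flip_apply,
        Submodule.subtype_apply]
      exact this
    exact LinearMap.congr_fun this α
  refine ⟨_, hs, fun s' hs' => LinearMap.ext fun β => cancel h _ _ fun x => ?_⟩
  rw [hs' x β, hs x β]

lemma star_map (h : k + l = m * 2)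
    (B : ⋀[ℝ]^k (DualV m) →ₗ[ℝ] ⋀[ℝ]^k (DualV m) →ₗ[ℝ] ℝ)
    (hB : ∀ v w : Fin k → DualV m,
      B (wedgeTuple m k v) (wedgeTuple m k w) =
        Matrix.det (Matrix.of fun i j => PiPairing (v i) (w j)))
    (star : ⋀[ℝ]^k (DualV m) →ₗ[ℝ] ⋀[ℝ]^l (DualV m)) (hs : IsStar B star)
    (β : ⋀[ℝ]^k (DualV m)) :
    star (exteriorPower.map k (JJ m) β) = exteriorPower.map l (JJ m) (star β) := by
  refine cancel h _ _ fun x => ?_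
  obtain ⟨y, rfl⟩ : ∃ y, exteriorPower.map k (JJ m) y = x := by
    refine ⟨(-1 : ℝ) ^ k • exteriorPower.map k (JJ m) x, ?_⟩
    rw [map_smul, map_map, smul_smul, ← mul_pow]
    simp
  rw [hs, B_map_map B hB, coe_map, coe_map, ← map_mul, hs, _root_.map_smul, map_symplVol]

lemma star_basis (h : k + l = m * 2)
    (B : ⋀[ℝ]^k (DualV m) →ₗ[ℝ] ⋀[ℝ]^k (DualV m) →ₗ[ℝ] ℝ)
    (hB : ∀ v w : Fin k → DualV m,
      B (wedgeTuple m k v) (wedgeTuple m k w) =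
        Matrix.det (Matrix.of fun i j => PiPairing (v i) (w j)))
    (star : ⋀[ℝ]^k (DualV m) →ₗ[ℝ] ⋀[ℝ]^l (DualV m)) (hs : IsStar B star)
    (S : Set.powersetCard (Fin (m * 2)) k) (ε : ℝ) (h1 : ε * ε = 1)
    (hε : ((bb m).exteriorPower k S : ExteriorAlgebra ℝ (DualV m)) *
      (bb m).exteriorPower l (cc h S) = ε • symplVol m) :
    star (exteriorPower.map k (JJ m) ((bb m).exteriorPower k S)) =
      ε • (bb m).exteriorPower l (cc h S) := by
  refine cancel h _ _ fun x => ?_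
  rw [hs, B_bb B hB]
  have : (((bb m).exteriorPower k).coord S).smulRight (symplVol m) =
      LinearMap.mulRight ℝ ((ε • (bb m).exteriorPower l (cc h S) : ⋀[ℝ]^l (DualV m)) :
        ExteriorAlgebra ℝ (DualV m)) ∘ₗ (⋀[ℝ]^k (DualV m)).subtype := by
    apply ((bb m).exteriorPower k).ext
    intro T
    simp only [LinearMap.comp_apply, LinearMap.mulRight_apply, LinearMap.smulRight_apply,
      Submodule.subtype_apply, Submodule.coe_smul, mul_smul_comm, Basis.coord_apply,
      Basis.repr_self]
    by_cases hT : T = S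
    · subst hT
      rw [hε, smul_smul, h1, Finsupp.single_eq_same]
    · rw [mul_ne h T S hT, Finsupp.single_eq_of_ne (Ne.symm hT), zero_smul, smul_zero]
  exact LinearMap.congr_fun this x

lemma star_star (h : k + l = m * 2)
    (B : ⋀[ℝ]^k (DualV m) →ₗ[ℝ] ⋀[ℝ]^k (DualV m) →ₗ[ℝ] ℝ)
    (hB : ∀ v w : Fin k → DualV m,
      B (wedgeTuple m k v) (wedgeTuple m k w) =
        Matrix.det (Matrix.of fun i j => PiPairing (v i) (w j)))
    (B' : ⋀[ℝ]^l (DualV m) →ₗ[ℝ] ⋀[ℝ]^l (DualV m) →ₗ[ℝ] ℝ)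
    (hB' : ∀ v w : Fin l → DualV m,
      B' (wedgeTuple m l v) (wedgeTuple m l w) =
        Matrix.det (Matrix.of fun i j => PiPairing (v i) (w j)))
    (star : ⋀[ℝ]^k (DualV m) →ₗ[ℝ] ⋀[ℝ]^l (DualV m)) (hs : IsStar B star)
    (star' : ⋀[ℝ]^l (DualV m) →ₗ[ℝ] ⋀[ℝ]^k (DualV m)) (hs' : IsStar B' star')
    (β : ⋀[ℝ]^k (DualV m)) : star' (star β) = β := by
  have h' : l + k = m * 2 := by omega
  have : star' ∘ₗ star = LinearMap.id := by
    apply ((bb m).exteriorPower k).ext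
    intro S
    obtain ⟨ε, h1, hε⟩ := exists_eps h S
    have hcc : cc h' (cc h S) = S := by
      apply Subtype.ext
      simp [cc]
    have hsq : ((-1 : ℝ) ^ (k * l)) * ((-1 : ℝ) ^ (k * l)) = 1 := by
      rw [← mul_pow]; simp
    have hkl : (-1 : ℝ) ^ k * (-1 : ℝ) ^ (k * l) = 1 := by
      rw [← pow_add]
      apply Even.neg_one_pow
      have h2 : Even (k + l) := ⟨m, by omega⟩
      rw [Nat.even_add] at h2
      rw [Nat.even_add, Nat.even_mul]
      tauto
    have hε' : ((bb m).exteriorPower l (cc h S) : ExteriorAlgebra ℝ (DualV m)) *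
        (bb m).exteriorPower k (cc h' (cc h S)) = ((-1 : ℝ) ^ (k * l) * ε) • symplVol m := by
      rw [hcc, mul_smul, ← hε, exteriorPower.basis_apply, exteriorPower.basis_apply]
      exact ιMulti_mul_comm k l _ _
    have e1 := star_basis h B hB star hs S ε h1 hε
    have e2 := star_basis h' B' hB' star' hs' (cc h S) _ (by
      rw [mul_mul_mul_comm, hsq, h1, one_mul]) hε'
    have e3 := map_map ((bb m).exteriorPower k S)
    have e4 : star' (star ((-1 : ℝ) ^ k • (bb m).exteriorPower k S)) =
        (-1 : ℝ) ^ (k * l) • (bb m).exteriorPower k S := by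
      rw [← e3, star_map h B hB star hs, e1, _root_.map_smul, _root_.map_smul, e2, hcc, smul_smul,
        mul_left_comm, h1, mul_one]
    rw [_root_.map_smul, _root_.map_smul] at e4
    have e5 := congrArg (fun z => (-1 : ℝ) ^ k • z) e4
    simp only [smul_smul, hkl, ← mul_pow] at e5
    simpa using e5
  exact LinearMap.congr_fun this β

end core

end SympStar

/-- The symplectic Hodge star squares to the identity: given the bilinear forms
`Λ^kΠ` and `Λ^{2m−k}Π` (characterized by the determinant formula on decomposables),
there is a unique linear map `∗ : Λ^k(V^*) → Λ^{2m−k}(V^*)` with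
`α ∧ (∗β) = Λ^kΠ(α, β) · ν`, and the composite of the star maps in degrees `k`
and `2m − k` is the identity. -/
theorem symplectic_hodge_star_sq (m k : ℕ) (hk : k ≤ 2 * m)
    (Bk : ⋀[ℝ]^k (DualV m) →ₗ[ℝ] ⋀[ℝ]^k (DualV m) →ₗ[ℝ] ℝ)
    (Bk' : ⋀[ℝ]^(2 * m - k) (DualV m) →ₗ[ℝ] ⋀[ℝ]^(2 * m - k) (DualV m) →ₗ[ℝ] ℝ)
    (hBk : ∀ v w : Fin k → DualV m,
      Bk (wedgeTuple m k v) (wedgeTuple m k w) =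
        Matrix.det (Matrix.of fun i j => PiPairing (v i) (w j)))
    (hBk' : ∀ v w : Fin (2 * m - k) → DualV m,
      Bk' (wedgeTuple m (2 * m - k) v) (wedgeTuple m (2 * m - k) w) =
        Matrix.det (Matrix.of fun i j => PiPairing (v i) (w j))) :
    (∃! star : ⋀[ℝ]^k (DualV m) →ₗ[ℝ] ⋀[ℝ]^(2 * m - k) (DualV m),
      ∀ α β : ⋀[ℝ]^k (DualV m),
        (α : ExteriorAlgebra ℝ (DualV m)) * (star β : ExteriorAlgebra ℝ (DualV m)) =
          Bk α β • symplVol m) ∧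
    (∀ (star : ⋀[ℝ]^k (DualV m) →ₗ[ℝ] ⋀[ℝ]^(2 * m - k) (DualV m))
       (star' : ⋀[ℝ]^(2 * m - k) (DualV m) →ₗ[ℝ] ⋀[ℝ]^k (DualV m)),
      (∀ α β : ⋀[ℝ]^k (DualV m),
        (α : ExteriorAlgebra ℝ (DualV m)) * (star β : ExteriorAlgebra ℝ (DualV m)) =
          Bk α β • symplVol m) →
      (∀ α β : ⋀[ℝ]^(2 * m - k) (DualV m),
        (α : ExteriorAlgebra ℝ (DualV m)) * (star' β : ExteriorAlgebra ℝ (DualV m)) =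
          Bk' α β • symplVol m) →
      ∀ β : ⋀[ℝ]^k (DualV m), star' (star β) = β) := by
  have h : k + (2 * m - k) = m * 2 := by omega
  refine ⟨SympStar.exists_star h Bk, fun star star' hs hs' β => ?_⟩
  exact SympStar.star_star h Bk hBk Bk' hBk' star hs star' hs' β
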